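/- arXiv:1609.01116 — 2 statements merged into one kernel-verified Lean document; each statement's English description precedes it below -/
import Mathlib

section
/- Let G be a finite connected simple graph that has two level-disjoint partitions S and T rooted at a vertex v, and let B be a block of G containing v. Then B has two level-disjoint partitions rooted at v, induced by S and T: for each of S and T, the tuple of intersections of its levels with V(B), truncated at the last nonempty intersection, is a level partition of B rooted at v, and these two induced level partitions are level-disjoint. -/
open SimpleGraph

variable {V : Type*}

/-- `L = (S_0, …, S_h)` is a level partition of the vertex set `U` with respect to the
adjacency relation `Adj`: the levels are nonempty, pairwise disjoint, their union is `U`,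
and every vertex of a level `S_i` (`i ≥ 1`) has a neighbor in the previous level `S_{i-1}`. -/
def IsLevelPartitionOn (Adj : V → V → Prop) (U : Set V) (L : List (Finset V)) : Prop :=
  L ≠ [] ∧
  (∀ i, i < L.length → (L.getD i ∅).Nonempty) ∧
  (∀ i j, i < L.length → j < L.length → i ≠ j → Disjoint (L.getD i ∅) (L.getD j ∅)) ∧
  (∀ x : V, x ∈ U ↔ ∃ i < L.length, x ∈ L.getD i ∅) ∧
  (∀ i, 1 ≤ i → i < L.length → ∀ u ∈ L.getD i ∅, ∃ w ∈ L.getD (i - 1) ∅, Adj u w)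

/-- A level partition of the graph `G` (on its whole vertex set). -/
def IsLevelPartition (G : SimpleGraph V) (L : List (Finset V)) : Prop :=
  IsLevelPartitionOn G.Adj Set.univ L

/-- A level partition is rooted at `v` if its level `0` is the singleton `{v}`. -/
def RootedAt (v : V) (L : List (Finset V)) : Prop :=
  L.getD 0 ∅ = {v}

/-- Two level partitions are level-disjoint if their levels `i` are disjoint
for every `1 ≤ i ≤ min(h, h')`. -/
def LevelDisjoint (L M : List (Finset V)) : Prop :=
  ∀ i, 1 ≤ i → i < L.length → i < M.length → Disjoint (L.getD i ∅) (M.getD i ∅)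

/-- The induced subgraph of `G` on `U` has no cut-vertex: deleting any vertex of `U`
leaves it preconnected. -/
def NoCutVertexOn (G : SimpleGraph V) (U : Set V) : Prop :=
  ∀ x ∈ U, (G.induce (U \ {x})).Preconnected

/-- `U` induces a block of `G`: a maximal connected induced subgraph without a cut-vertex. -/
def IsBlockSet (G : SimpleGraph V) (U : Set V) : Prop :=
  (G.induce U).Connected ∧ NoCutVertexOn G U ∧
  ∀ W : Set V, U ⊆ W → (G.induce W).Connected → NoCutVertexOn G W → W = U

/-- The induced subgraph of `G` on `U` is 2-connected: connected, with at least 3 vertices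
and no cut-vertex. -/
def TwoConnectedOn (G : SimpleGraph V) (U : Set V) : Prop :=
  (G.induce U).Connected ∧ 3 ≤ U.ncard ∧ NoCutVertexOn G U

/-- Remove the trailing empty sets of a list of finite sets (i.e. truncate the list at its
last nonempty entry). -/
def dropTrailingEmpty {V : Type*} [DecidableEq V] (L : List (Finset V)) : List (Finset V) :=
  (L.reverse.dropWhile fun s => decide (s = ∅)).reverse

/-- Truncating the trailing empty sets does not change the entries of a list, when entries
beyond the end are read as `∅`. -/
theorem getD_dropTrailingEmpty {V : Type*} [DecidableEq V] (L : List (Finset V)) (i : ℕ) :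
    (dropTrailingEmpty L).getD i ∅ = L.getD i ∅ := by
  induction L using List.reverseRecOn with
  | nil => simp [dropTrailingEmpty]
  | append_singleton L s ih =>
    by_cases hs : s = ∅
    · have h : dropTrailingEmpty (L ++ [s]) = dropTrailingEmpty L := by
        simp [dropTrailingEmpty, hs]
      rw [h, ih]
      rcases lt_trichotomy i L.length with hi | rfl | hi
      · rw [List.getD_append _ _ _ _ hi]
      · simp [hs]
      · rw [List.getD_eq_default _ _ hi.le, List.getD_eq_default]
        simpa using hi
    · have h : dropTrailingEmpty (L ++ [s]) = L ++ [s] := by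
        simp [dropTrailingEmpty, hs]
      rw [h]

/-- An index survives the truncation only if it is followed by, or is itself the index of,
a nonempty entry. -/
theorem exists_nonempty_of_lt_length_dropTrailingEmpty {V : Type*} [DecidableEq V]
    (L : List (Finset V)) {i : ℕ} (hi : i < (dropTrailingEmpty L).length) :
    ∃ j, i ≤ j ∧ (L.getD j ∅).Nonempty := by
  induction L using List.reverseRecOn with
  | nil => simp [dropTrailingEmpty] at hi
  | append_singleton L s ih =>
    by_cases hs : s = ∅
    · have h : dropTrailingEmpty (L ++ [s]) = dropTrailingEmpty L := by
        simp [dropTrailingEmpty, hs]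
      rw [h] at hi
      obtain ⟨j, hij, hj⟩ := ih hi
      refine ⟨j, hij, ?_⟩
      have hjL : j < L.length := by
        by_contra hcon
        rw [List.getD_eq_default _ _ (not_lt.mp hcon)] at hj
        exact Finset.not_nonempty_empty hj
      rwa [List.getD_append _ _ _ _ hjL]
    · have h : dropTrailingEmpty (L ++ [s]) = L ++ [s] := by
        simp [dropTrailingEmpty, hs]
      rw [h, List.length_append, List.length_singleton] at hi
      refine ⟨L.length, Nat.lt_succ_iff.mp hi, ?_⟩
      simpa using Finset.nonempty_iff_ne_empty.mpr hs

theorem lt_length_of_mem_getD {V : Type*} {L : List (Finset V)} {i : ℕ} {x : V}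
    (hx : x ∈ L.getD i ∅) : i < L.length := by
  by_contra h
  rw [List.getD_eq_default _ _ (not_lt.mp h)] at hx
  exact Finset.notMem_empty x hx

theorem getD_map_inter {V : Type*} [DecidableEq V] (L : List (Finset V)) (B : Finset V)
    (i : ℕ) : (L.map fun s => s ∩ B).getD i ∅ = L.getD i ∅ ∩ B := by
  have h := List.getD_map (l := L) (d := ∅) (n := i) (fun s => s ∩ B)
  rwa [Finset.empty_inter] at h

/-- Consecutively adjacent vertices that all lie in `U` are connected within `U`. -/
theorem induce_reachable_of_sequence {V : Type*} {G : SimpleGraph V} {U : Set V} {p : ℕ → V}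
    {a b : ℕ} (hab : a ≤ b) (hU : ∀ k, a ≤ k → k ≤ b → p k ∈ U)
    (hp : ∀ k, a ≤ k → k < b → G.Adj (p k) (p (k + 1))) :
    (G.induce U).Reachable ⟨p a, hU a le_rfl hab⟩ ⟨p b, hU b hab le_rfl⟩ := by
  induction b, hab using Nat.le_induction with
  | base => exact Reachable.refl _
  | succ b hab ih =>
    have hadj : (G.induce U).Adj ⟨p b, hU b hab b.le_succ⟩
        ⟨p (b + 1), hU (b + 1) (hab.trans b.le_succ) le_rfl⟩ := hp b hab b.lt_succ_self
    exact (ih (fun k h₁ h₂ => hU k h₁ (h₂.trans b.le_succ))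
      (fun k h₁ h₂ => hp k h₁ (h₂.trans b.lt_succ_self))).trans hadj.reachable

/-- If every vertex of `W` is connected within `W` to a vertex of a set inducing a
preconnected subgraph, then `W` induces a preconnected subgraph. -/
theorem induce_preconnected_of_reachable {V : Type*} {G : SimpleGraph V} {A W : Set V}
    (hAW : A ⊆ W) (hA : (G.induce A).Preconnected)
    (h : ∀ w : W, ∃ a : A, (G.induce W).Reachable w ⟨a, hAW a.2⟩) :
    (G.induce W).Preconnected := by
  intro x y
  obtain ⟨a, ha⟩ := h x
  obtain ⟨b, hb⟩ := h y
  exact ha.trans (((hA a b).map (G.induceHomOfLE hAW).toHom).trans hb.symm)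

/-- A path whose ends lie in a block stays in the block. -/
theorem IsBlockSet.mem_of_path {V : Type*} {G : SimpleGraph V} {B : Set V}
    (hB : IsBlockSet G B) {p : ℕ → V} {n : ℕ} (hp : ∀ k < n, G.Adj (p k) (p (k + 1)))
    (hinj : Set.InjOn p (Set.Iic n)) (h₀ : p 0 ∈ B) (hn : p n ∈ B)
    {k : ℕ} (hk : k ≤ n) : p k ∈ B := by
  obtain ⟨hconn, hcut, hmax⟩ := hB
  set W : Set V := B ∪ p '' Set.Iic n
  have hBW : B ⊆ W := Set.subset_union_left
  have hpW : ∀ k ≤ n, p k ∈ W := fun k hk => Or.inr ⟨k, hk, rfl⟩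
  have hWconn : (G.induce W).Connected := by
    have : Nonempty W := ⟨⟨p 0, hBW h₀⟩⟩
    refine ⟨induce_preconnected_of_reachable hBW hconn.preconnected ?_⟩
    rintro ⟨w, hw | ⟨k, hk, rfl⟩⟩
    · exact ⟨⟨w, hw⟩, Reachable.refl _⟩
    · have hk : k ≤ n := hk
      exact ⟨⟨p 0, h₀⟩, (induce_reachable_of_sequence k.zero_le
        (fun j _ hj => hpW j (hj.trans hk)) (fun j _ hj => hp j (hj.trans_le hk))).symm⟩
  have hWcut : NoCutVertexOn G W := by
    intro x _
    have hBx : (G.induce (B \ {x})).Preconnected := by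
      by_cases hx : x ∈ B
      · exact hcut x hx
      · rw [Set.sdiff_singleton_eq_self hx]
        exact hconn.preconnected
    refine induce_preconnected_of_reachable (Set.sdiff_subset_sdiff_left hBW) hBx ?_
    rintro ⟨w, hw | ⟨k, hk, rfl⟩, hwx⟩
    · exact ⟨⟨w, hw, hwx⟩, Reachable.refl _⟩
    · have hk : k ≤ n := hk
      -- The deleted vertex occurs at most once, so it misses one of the two sides of `p k`.
      by_cases hlow : ∀ j ≤ k, p j ≠ x
      · exact ⟨⟨p 0, h₀, hlow 0 k.zero_le⟩,
          (induce_reachable_of_sequence (U := W \ {x}) k.zero_le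
          (fun j _ hj => ⟨hpW j (hj.trans hk), hlow j hj⟩)
          (fun j _ hj => hp j (hj.trans_le hk))).symm⟩
      · push Not at hlow
        obtain ⟨m, hmk, rfl⟩ := hlow
        have hmk' : m ≠ k := fun h => hwx (h ▸ rfl)
        have hhigh : ∀ j, k ≤ j → j ≤ n → p j ≠ p m := fun j hkj hjn hj => by
          have : j = m := hinj hjn (hmk.trans hk) hj
          omega
        exact ⟨⟨p n, hn, hhigh n hk le_rfl⟩, induce_reachable_of_sequence (U := W \ {p m}) hk
          (fun j hkj hjn => ⟨hpW j hjn, hhigh j hkj hjn⟩) (fun j _ hj => hp j hj)⟩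
  have hWB : W = B := hmax W hBW hWconn hWcut
  exact hWB ▸ hpW k hk

/-- A vertex at level `i` ends a sequence of consecutively adjacent vertices whose `k`-th term
lies at level `k`. -/
theorem IsLevelPartition.exists_sequence {V : Type*} {G : SimpleGraph V} {L : List (Finset V)}
    (hL : IsLevelPartition G L) {i : ℕ} {u : V} (hu : u ∈ L.getD i ∅) :
    ∃ p : ℕ → V, p i = u ∧ (∀ k ≤ i, p k ∈ L.getD k ∅) ∧
      ∀ k < i, G.Adj (p k) (p (k + 1)) := by
  induction i generalizing u with
  | zero => exact ⟨fun _ => u, rfl, fun k hk => by rwa [Nat.le_zero.mp hk], by simp⟩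
  | succ i ih =>
    obtain ⟨w, hw, huw⟩ := hL.2.2.2.2 (i + 1) (by omega) (lt_length_of_mem_getD hu) u hu
    obtain ⟨p, rfl, hmem, hadj⟩ := ih hw
    refine ⟨Function.update p (i + 1) u, by simp, fun k hk => ?_, fun k hk => ?_⟩
    · rcases hk.lt_or_eq with hk | rfl
      · rw [Function.update_of_ne hk.ne]
        exact hmem k (Nat.lt_succ_iff.mp hk)
      · simpa using hu
    · rw [Function.update_of_ne hk.ne]
      rcases (Nat.lt_succ_iff.mp hk).lt_or_eq with hk | rfl
      · rw [Function.update_of_ne (by omega)]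
        exact hadj k hk
      · simpa using huw.symm

/-- In a level partition rooted in a block, every vertex of the block other than the root
has a neighbor in the block on the previous level. -/
theorem IsLevelPartition.exists_adj_mem_block {V : Type*} {G : SimpleGraph V}
    {L : List (Finset V)} (hL : IsLevelPartition G L) {v : V} (hv : RootedAt v L) {B : Set V}
    (hB : IsBlockSet G B) (hvB : v ∈ B) {i : ℕ} {u : V} (hu : u ∈ L.getD (i + 1) ∅)
    (huB : u ∈ B) : ∃ w ∈ L.getD i ∅, w ∈ B ∧ G.Adj u w := by
  obtain ⟨p, rfl, hmem, hadj⟩ := hL.exists_sequence hu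
  have hp₀ : p 0 = v := by
    have h := hmem 0 (Nat.zero_le _)
    rw [hv] at h
    exact Finset.mem_singleton.mp h
  have hinj : Set.InjOn p (Set.Iic (i + 1)) := by
    intro a ha b hb hab
    by_contra hne
    have hpa := hmem a ha
    have hpb := hmem b hb
    exact Finset.disjoint_left.mp (hL.2.2.1 a b (lt_length_of_mem_getD hpa)
      (lt_length_of_mem_getD hpb) hne) hpa (hab ▸ hpb)
  exact ⟨p i, hmem i i.le_succ, hB.mem_of_path hadj hinj (hp₀ ▸ hvB) huB
    i.le_succ, (hadj i i.lt_succ_self).symm⟩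

/-- A level partition rooted at a vertex of a block induces a level partition of the block. -/
theorem IsLevelPartition.restrict_block {V : Type*} [DecidableEq V] {G : SimpleGraph V}
    {L : List (Finset V)} (hL : IsLevelPartition G L) {v : V} (hv : RootedAt v L)
    {B : Finset V} (hB : IsBlockSet G (B : Set V)) (hvB : v ∈ B) :
    IsLevelPartitionOn (fun x y => G.Adj x y ∧ x ∈ B ∧ y ∈ B) (B : Set V)
      (dropTrailingEmpty (L.map fun s => s ∩ B)) := by
  have hget : ∀ i, (dropTrailingEmpty (L.map fun s => s ∩ B)).getD i ∅ = L.getD i ∅ ∩ B :=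
    fun i => by rw [getD_dropTrailingEmpty, getD_map_inter]
  have hstep : ∀ i, ∀ u ∈ L.getD (i + 1) ∅ ∩ B,
      ∃ w ∈ L.getD i ∅ ∩ B, G.Adj u w ∧ u ∈ B ∧ w ∈ B := by
    intro i u hu
    obtain ⟨hu, huB⟩ := Finset.mem_inter.mp hu
    obtain ⟨w, hw, hwB, huw⟩ := hL.exists_adj_mem_block hv hB hvB hu huB
    exact ⟨w, Finset.mem_inter.mpr ⟨hw, hwB⟩, huw, huB, hwB⟩
  refine ⟨?_, ?_, ?_, ?_, ?_⟩
  · refine List.ne_nil_of_length_pos (lt_length_of_mem_getD (i := 0) (x := v) ?_)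
    rw [hget, hv]
    simpa using hvB
  · intro i hi
    obtain ⟨j, hij, hj⟩ := exists_nonempty_of_lt_length_dropTrailingEmpty _ hi
    rw [getD_map_inter] at hj
    rw [hget]
    induction j, hij using Nat.le_induction with
    | base => exact hj
    | succ j _ ih =>
      obtain ⟨u, hu⟩ := hj
      obtain ⟨w, hw, _⟩ := hstep j u hu
      exact ih ⟨w, hw⟩
  · intro i j _ _ hij
    rw [hget, hget, Finset.disjoint_left]
    intro x hx hy
    have hx := (Finset.mem_inter.mp hx).1
    have hy := (Finset.mem_inter.mp hy).1
    exact Finset.disjoint_left.mp (hL.2.2.1 i j (lt_length_of_mem_getD hx)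
      (lt_length_of_mem_getD hy) hij) hx hy
  · intro x
    constructor
    · intro hx
      obtain ⟨i, _, hi⟩ := (hL.2.2.2.1 x).mp (Set.mem_univ x)
      have hxi : x ∈ (dropTrailingEmpty (L.map fun s => s ∩ B)).getD i ∅ := by
        rw [hget]
        exact Finset.mem_inter.mpr ⟨hi, hx⟩
      exact ⟨i, lt_length_of_mem_getD hxi, hxi⟩
    · rintro ⟨i, _, hi⟩
      rw [hget] at hi
      exact (Finset.mem_inter.mp hi).2
  · intro i hi _ u hu
    obtain ⟨i, rfl⟩ := Nat.exists_eq_add_of_le' hi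
    rw [hget] at hu
    rw [Nat.add_sub_cancel, hget]
    exact hstep i u hu

theorem RootedAt.restrict {V : Type*} [DecidableEq V] {L : List (Finset V)} {v : V}
    (hv : RootedAt v L) {B : Finset V} (hvB : v ∈ B) :
    RootedAt v (dropTrailingEmpty (L.map fun s => s ∩ B)) := by
  rw [RootedAt, getD_dropTrailingEmpty, getD_map_inter, hv]
  exact Finset.inter_eq_left.mpr (Finset.singleton_subset_iff.mpr hvB)

theorem LevelDisjoint.restrict {V : Type*} [DecidableEq V] {L M : List (Finset V)}
    (h : LevelDisjoint L M) (B : Finset V) :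
    LevelDisjoint (dropTrailingEmpty (L.map fun s => s ∩ B))
      (dropTrailingEmpty (M.map fun s => s ∩ B)) := by
  intro i hi _ _
  simp only [getD_dropTrailingEmpty, getD_map_inter]
  rw [Finset.disjoint_left]
  intro x hx hy
  have hx := (Finset.mem_inter.mp hx).1
  have hy := (Finset.mem_inter.mp hy).1
  exact Finset.disjoint_left.mp
    (h i hi (lt_length_of_mem_getD hx) (lt_length_of_mem_getD hy)) hx hy

/-- If `S` and `T` are two level-disjoint partitions of a finite connected
graph `G` rooted at `v` and `B` is a block of `G` containing `v`, then the tuples of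
intersections of the levels of `S` (resp. `T`) with `B`, truncated at the last nonempty
intersection, are two level-disjoint partitions of (the induced subgraph on) `B` rooted
at `v`. -/
theorem rooted_LDPs_restrict_to_block {V : Type*} [Fintype V] [DecidableEq V]
    (G : SimpleGraph V) (hG : G.Connected) (v : V)
    (B : Finset V) (hB : IsBlockSet G (B : Set V)) (hvB : v ∈ B)
    (S T : List (Finset V))
    (hS : IsLevelPartition G S) (hSroot : RootedAt v S)
    (hT : IsLevelPartition G T) (hTroot : RootedAt v T)
    (hST : LevelDisjoint S T) :
    IsLevelPartitionOn (fun x y => G.Adj x y ∧ x ∈ B ∧ y ∈ B) (B : Set V)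
      (dropTrailingEmpty (S.map fun s => s ∩ B)) ∧
    RootedAt v (dropTrailingEmpty (S.map fun s => s ∩ B)) ∧
    IsLevelPartitionOn (fun x y => G.Adj x y ∧ x ∈ B ∧ y ∈ B) (B : Set V)
      (dropTrailingEmpty (T.map fun s => s ∩ B)) ∧
    RootedAt v (dropTrailingEmpty (T.map fun s => s ∩ B)) ∧
    LevelDisjoint (dropTrailingEmpty (S.map fun s => s ∩ B))
      (dropTrailingEmpty (T.map fun s => s ∩ B)) := by
  exact ⟨hS.restrict_block hSroot hB hvB, hSroot.restrict hvB, hT.restrict_block hTroot hB hvB,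
    hTroot.restrict hvB, hST.restrict B⟩
end

section
/- Let G be a finite 2-connected non-bipartite simple graph and let v be any vertex of G. Then G has two level-disjoint partitions rooted at v. -/
open SimpleGraph

variable {V : Type*}

/-- `f` is a depth function of a spanning tree of `G[U]` rooted at `v`. -/
def IsDepthOn (G : SimpleGraph V) (v : V) (U : Finset V) (f : V → ℕ) : Prop :=
  f v = 0 ∧ ∀ x ∈ U, x ≠ v → ∃ y ∈ U, G.Adj x y ∧ f x = f y + 1

/-- Hanging a new vertex `x` below `a ∈ U` extends a depth function to `insert x U`. -/
theorem IsDepthOn.insert_update [DecidableEq V] {G : SimpleGraph V} {v : V} {U : Finset V}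
    {f : V → ℕ} (hf : IsDepthOn G v U f) (hv : v ∈ U) {a x : V} (ha : a ∈ U) (hx : x ∉ U)
    (hax : G.Adj a x) : IsDepthOn G v (insert x U) (Function.update f x (f a + 1)) := by
  have hne : ∀ y ∈ U, y ≠ x := fun y hy h => hx (h ▸ hy)
  refine ⟨by rw [Function.update_of_ne (hne v hv)]; exact hf.1, fun z hz hzv => ?_⟩
  rcases Finset.mem_insert.1 hz with rfl | hz
  · exact ⟨a, Finset.mem_insert_of_mem ha, hax.symm, by
      rw [Function.update_self, Function.update_of_ne (hne a ha)]⟩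
  · obtain ⟨y, hy, hzy, he⟩ := hf.2 z hz hzv
    exact ⟨y, Finset.mem_insert_of_mem hy, hzy, by
      rw [Function.update_of_ne (hne z hz), Function.update_of_ne (hne y hy), he]⟩

/-- The list of level sets of `f`. -/
def levelList [Fintype V] (f : V → ℕ) : List (Finset V) :=
  (List.range (Finset.univ.sup f + 1)).map fun i => Finset.univ.filter fun x => f x = i

theorem mem_levelList_getD [Fintype V] (f : V → ℕ) (i : ℕ) (x : V) :
    x ∈ (levelList f).getD i ∅ ↔ f x = i := by
  have hle : f x ≤ Finset.univ.sup f := Finset.le_sup (Finset.mem_univ x)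
  by_cases hi : i < Finset.univ.sup f + 1
  · simp [levelList, List.getD, hi]
  · rw [List.getD_eq_default _ _ (by simpa [levelList] using hi)]
    simp only [Finset.notMem_empty, false_iff]
    omega

theorem IsDepthOn.exists_eq [Fintype V] {G : SimpleGraph V} {v : V} {f : V → ℕ}
    (hf : IsDepthOn G v Finset.univ f) {i : ℕ} (hi : i ≤ Finset.univ.sup f) :
    ∃ x, f x = i := by
  induction hi using Nat.decreasingInduction with
  | self =>
    obtain ⟨x, -, hx⟩ := Finset.exists_mem_eq_sup Finset.univ ⟨v, Finset.mem_univ v⟩ f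
    exact ⟨x, hx.symm⟩
  | of_succ k _ ih =>
    obtain ⟨x, hx⟩ := ih
    obtain ⟨y, -, -, hy⟩ := hf.2 x (Finset.mem_univ x) (by rintro rfl; have := hf.1; omega)
    exact ⟨y, by omega⟩

theorem IsDepthOn.isLevelPartition [Fintype V] {G : SimpleGraph V} {v : V} {f : V → ℕ}
    (hf : IsDepthOn G v Finset.univ f) :
    IsLevelPartition G (levelList f) ∧ RootedAt v (levelList f) := by
  have hlen : (levelList f).length = Finset.univ.sup f + 1 := by simp [levelList]
  refine ⟨⟨?_, ?_, ?_, ?_, ?_⟩, ?_⟩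
  · intro h
    simp [h] at hlen
  · intro i hi
    obtain ⟨x, hx⟩ := hf.exists_eq (i := i) (by omega)
    exact ⟨x, (mem_levelList_getD f i x).2 hx⟩
  · intro i j _ _ hij
    rw [Finset.disjoint_left]
    intro x hx hx'
    rw [mem_levelList_getD] at hx hx'
    omega
  · intro x
    have hle : f x ≤ Finset.univ.sup f := Finset.le_sup (Finset.mem_univ x)
    exact iff_of_true trivial ⟨f x, by omega, (mem_levelList_getD f _ x).2 rfl⟩
  · intro i hi _ u hu
    rw [mem_levelList_getD] at hu
    obtain ⟨y, -, hy, he⟩ := hf.2 u (Finset.mem_univ u) (by rintro rfl; have := hf.1; omega)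
    exact ⟨y, (mem_levelList_getD f _ y).2 (by omega), hy⟩
  · ext x
    rw [mem_levelList_getD, Finset.mem_singleton]
    constructor
    · intro hx
      by_contra hxv
      obtain ⟨y, -, -, hy⟩ := hf.2 x (Finset.mem_univ x) hxv
      omega
    · rintro rfl
      exact hf.1

/-- Two depth functions that differ on `U` away from the root extend to the whole graph if deleting
the root leaves a connected graph. -/
theorem exists_isDepthOn_univ [Fintype V] [DecidableEq V] {G : SimpleGraph V} {v : V}
    (hconn : (G.induce {v}ᶜ).Preconnected) {U : Finset V} {f g : V → ℕ}
    (hv : v ∈ U) {u : V} (hu : u ∈ U) (huv : u ≠ v)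
    (hf : IsDepthOn G v U f) (hg : IsDepthOn G v U g)
    (hfg : ∀ x ∈ U, x ≠ v → f x ≠ g x) :
    ∃ f g : V → ℕ, IsDepthOn G v Finset.univ f ∧ IsDepthOn G v Finset.univ g ∧
      ∀ x, x ≠ v → f x ≠ g x := by
  induction hn : Uᶜ.card generalizing U f g with
  | zero =>
    have hU : U = Finset.univ := by simpa using hn
    subst hU
    exact ⟨f, g, hf, hg, fun x => hfg x (Finset.mem_univ x)⟩
  | succ n ih =>
    obtain ⟨x, hx⟩ : Uᶜ.Nonempty := Finset.card_pos.1 (by omega)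
    rw [Finset.mem_compl] at hx
    have hxv : x ≠ v := fun h => hx (h ▸ hv)
    obtain ⟨p⟩ := hconn ⟨u, huv⟩ ⟨x, hxv⟩
    obtain ⟨d, -, hd1, hd2⟩ := p.exists_boundary_dart {z | z.1 ∈ U} hu hx
    obtain ⟨⟨⟨a, hav⟩, ⟨b, hbv⟩⟩, hab⟩ := d
    have ha : a ∈ U := hd1
    have hb : b ∉ U := hd2
    have hab' : G.Adj a b := hab
    refine ih (Finset.mem_insert_of_mem hv) (Finset.mem_insert_of_mem hu)
      (hf.insert_update hv ha hb hab') (hg.insert_update hv ha hb hab') ?_ ?_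
    · intro z hz hzv
      rcases Finset.mem_insert.1 hz with rfl | hz
      · have := hfg a ha hav
        simpa using this
      · have hzb : z ≠ b := fun h => hb (h ▸ hz)
        rw [Function.update_of_ne hzb, Function.update_of_ne hzb]
        exact hfg z hz hzv
    · have h1 := Finset.card_compl (insert b U)
      have h2 := Finset.card_compl U
      rw [Finset.card_insert_of_notMem hb] at h1
      omega

/-- Walking around an odd cycle in both directions gives two different depths at every vertex. -/
theorem exists_isDepthOn_of_odd_closed_walk [DecidableEq V] {G : SimpleGraph V} {v : V}
    (c : G.Walk v v) (hodd : Odd c.length) (hnodup : c.support.tail.Nodup) :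
    ∃ (U : Finset V) (f g : V → ℕ), v ∈ U ∧ (∃ u ∈ U, u ≠ v) ∧
      IsDepthOn G v U f ∧ IsDepthOn G v U g ∧ ∀ x ∈ U, x ≠ v → f x ≠ g x := by
  classical
  set n := c.length with hn
  have hinj : ∀ i j, 1 ≤ i → i ≤ n → 1 ≤ j → j ≤ n → c.getVert i = c.getVert j → i = j := by
    intro i j hi hi' hj hj' hij
    have key : ∀ k, 1 ≤ k → k ≤ n → c.support.tail[k - 1]? = some (c.getVert k) := by
      intro k hk hk'
      rw [List.getElem?_tail, Nat.sub_add_cancel hk, ← Walk.getVert_eq_support_getElem? c hk']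
    have hlen : c.support.tail.length = n := by simp [hn]
    have := (List.getElem?_inj (i := i - 1) (j := j - 1) (by omega) hnodup).1
      (by rw [key i hi hi', key j hj hj', hij])
    omega
  have hidx : ∀ x : V, ∃ i, x ∈ c.support → i < n ∧ c.getVert i = x := by
    intro x
    by_cases hx : x ∈ c.support
    · obtain ⟨i, hi, hin⟩ := Walk.mem_support_iff_exists_getVert.1 hx
      rcases hin.lt_or_eq with h | h
      · exact ⟨i, fun _ => ⟨h, hi⟩⟩
      · refine ⟨0, fun _ => ⟨hodd.pos, ?_⟩⟩
        rw [← hi, h, Walk.getVert_length, Walk.getVert_zero]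
    · exact ⟨0, fun h => absurd h hx⟩
  choose idx hidx using hidx
  have hpos : ∀ x ∈ c.support, x ≠ v → 1 ≤ idx x := by
    intro x hx hxv
    by_contra h
    have h0 : idx x = 0 := by omega
    have := (hidx x hx).2
    rw [h0, Walk.getVert_zero] at this
    exact hxv this.symm
  have hgetn : c.getVert n = v := Walk.getVert_length c
  have hne : ∀ i, 1 ≤ i → i < n → c.getVert i ≠ v := by
    intro i hi hin h
    have := hinj i n hi hin.le hodd.pos le_rfl (h.trans hgetn.symm)
    omega
  have hidxget : ∀ i, 1 ≤ i → i < n → idx (c.getVert i) = i := by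
    intro i hi hin
    have hm := Walk.getVert_mem_support c i
    have := hidx _ hm
    exact hinj _ _ (hpos _ hm (hne i hi hin)) this.1.le hi hin.le this.2
  refine ⟨c.support.toFinset, fun x => if x = v then 0 else idx x,
    fun x => if x = v then 0 else n - idx x, by simp, ?_, ⟨by simp, ?_⟩, ⟨by simp, ?_⟩, ?_⟩
  · have h1 : 1 < n := by
      have := hodd.pos
      by_contra h
      have h1 : n = 1 := by omega
      have := Walk.adj_getVert_succ c (i := 0) (by omega)
      rw [Walk.getVert_zero, zero_add, ← h1, hgetn] at this
      exact G.loopless.irrefl v this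
    exact ⟨c.getVert 1, by simp, hne 1 le_rfl h1⟩
  · intro x hx hxv
    rw [List.mem_toFinset] at hx
    obtain ⟨hlt, hget⟩ := hidx x hx
    have hp := hpos x hx hxv
    have hadj := Walk.adj_getVert_succ c (i := idx x - 1) (by omega)
    rw [Nat.sub_add_cancel hp, hget] at hadj
    refine ⟨_, by simp, hadj.symm, ?_⟩
    rcases hp.eq_or_lt with h | h
    · simp [hxv, ← h]
    · have := hidxget (idx x - 1) (by omega) (by omega)
      simp only [hxv, hne (idx x - 1) (by omega) (by omega), if_false, this]
      omega
  · intro x hx hxv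
    rw [List.mem_toFinset] at hx
    obtain ⟨hlt, hget⟩ := hidx x hx
    have hp := hpos x hx hxv
    have hadj := Walk.adj_getVert_succ c (i := idx x) hlt
    rw [hget] at hadj
    refine ⟨_, by simp, hadj, ?_⟩
    rcases (Nat.succ_le_of_lt hlt).eq_or_lt with h | h
    · have h' : c.getVert (idx x + 1) = v := (congrArg c.getVert h).trans hgetn
      simp only [hxv, h', if_true, if_false]
      omega
    · have := hidxget (idx x + 1) (by omega) h
      simp only [hxv, hne (idx x + 1) (by omega) h, if_false, this]
      omega
  · intro x hx hxv
    rw [List.mem_toFinset] at hx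
    have := hidx x hx
    obtain ⟨m, hm⟩ := hodd
    simp only [hxv, if_false]
    omega

/-- `x` has a neighbor in `B` that is `v` or has smaller rank. -/
def HasLower (G : SimpleGraph V) (v : V) (B : Finset V) (r : V → ℚ) (x : V) : Prop :=
  ∃ y ∈ B, G.Adj x y ∧ (y = v ∨ r y < r x)

/-- `x` has a neighbor in `B` that is `v` or has larger rank. -/
def HasUpper (G : SimpleGraph V) (v : V) (B : Finset V) (r : V → ℚ) (x : V) : Prop :=
  ∃ y ∈ B, G.Adj x y ∧ (y = v ∨ r x < r y)

/-- `r` is an st-numbering of `G[B]` with `s = t = v`. -/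
structure IsSTNumbering (G : SimpleGraph V) (v : V) (B : Finset V) (r : V → ℚ) : Prop where
  injOn : Set.InjOn r B
  lower : ∀ x ∈ B, x ≠ v → HasLower G v B r x
  upper : ∀ x ∈ B, x ≠ v → HasUpper G v B r x

/-- Inserting an ear `p` from `q` down to `a` into an st-numbering in which only `q` may lack
a lower neighbor. -/
theorem exists_isSTNumbering_of_ear [DecidableEq V] {G : SimpleGraph V} {v : V} {a q : V}
    (p : G.Walk q a) (hp : p.IsPath) {B : Finset V} {r : V → ℚ} {m : ℚ}
    (hv : v ∈ B) (ha : a ∈ B) (hq : q ∈ B) (hqa : q ≠ a) (hm : m < r q)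
    (ham : a = v ∨ r a ≤ m) (hdisj : ∀ w ∈ p.support, w = q ∨ w = a ∨ w ∉ B)
    (hinj : Set.InjOn r B) (hlower : ∀ x ∈ B, x ≠ v → x ≠ q → HasLower G v B r x)
    (hupper : ∀ x ∈ B, x ≠ v → HasUpper G v B r x) :
    ∃ (B' : Finset V) (r' : V → ℚ), B ⊆ B' ∧ (∀ w ∈ p.support, w ∈ B') ∧
      IsSTNumbering G v B' r' := by
  induction p generalizing B r with
  | nil => exact absurd rfl hqa
  | @cons q u a h p ih =>
    rw [Walk.cons_isPath_iff] at hp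
    by_cases hua : u = a
    · subst hua
      have hnil : p = Walk.nil := Walk.eq_nil_iff_nil.2 (Walk.isPath_iff_nil.1 hp.1)
      refine ⟨B, r, subset_rfl, ?_, hinj, ?_, hupper⟩
      · intro w hw
        simp only [hnil, Walk.support_cons, Walk.support_nil, List.mem_cons, List.not_mem_nil,
          or_false] at hw
        rcases hw with rfl | rfl <;> assumption
      · intro x hx hxv
        by_cases hxq : x = q
        · subst hxq
          exact ⟨u, ha, h, ham.imp_right fun h' => h'.trans_lt hm⟩
        · exact hlower x hx hxv hxq
    · have huq : u ≠ q := h.ne'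
      have huB : u ∉ B := by
        rcases hdisj u (by simp) with h' | h' | h'
        exacts [absurd h' huq, absurd h' hua, h']
      obtain ⟨t, ⟨htm, htq⟩, htB⟩ :=
        (Set.Ioo_infinite hm).exists_notMem_finset (B.image r)
      have hne : ∀ y ∈ B, y ≠ u := fun y hy h' => huB (h' ▸ hy)
      have hr : ∀ y ∈ B, Function.update r u t y = r y := fun y hy =>
        Function.update_of_ne (hne y hy) _ _
      have hru : Function.update r u t u = t := Function.update_self ..
      have hdisj' : ∀ w ∈ p.support, w = u ∨ w = a ∨ w ∉ insert u B := by
        intro w hw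
        have hwq : w ≠ q := fun h' => hp.2 (h' ▸ hw)
        by_cases hwu : w = u
        · exact Or.inl hwu
        · rcases hdisj w (by simp [hw]) with h' | h' | h'
          · exact absurd h' hwq
          · exact Or.inr (Or.inl h')
          · exact Or.inr (Or.inr (by simp [hwu, h']))
      have hinj' : Set.InjOn (Function.update r u t) (insert u B : Finset V) := by
        rw [Finset.coe_insert, Set.injOn_insert (by simpa using huB)]
        refine ⟨fun x hx y hy hxy => hinj hx hy ?_, ?_⟩
        · rwa [hr x hx, hr y hy] at hxy
        · rw [hru]
          rintro ⟨y, hy, hyt⟩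
          rw [hr y hy] at hyt
          exact htB (Finset.mem_image.2 ⟨y, hy, hyt⟩)
      have hlower' : ∀ x ∈ insert u B, x ≠ v → x ≠ u →
          HasLower G v (insert u B) (Function.update r u t) x := by
        intro x hx hxv hxu
        have hxB : x ∈ B := (Finset.mem_insert.1 hx).resolve_left hxu
        by_cases hxq : x = q
        · subst hxq
          exact ⟨u, Finset.mem_insert_self u B, h, Or.inr (by rwa [hru, hr x hxB])⟩
        · obtain ⟨y, hy, hxy, hyr⟩ := hlower x hxB hxv hxq
          exact ⟨y, Finset.mem_insert_of_mem hy, hxy, by rwa [hr y hy, hr x hxB]⟩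
      have hupper' : ∀ x ∈ insert u B, x ≠ v →
          HasUpper G v (insert u B) (Function.update r u t) x := by
        intro x hx hxv
        rcases Finset.mem_insert.1 hx with rfl | hxB
        · exact ⟨q, Finset.mem_insert_of_mem hq, h.symm, Or.inr (by rwa [hru, hr q hq])⟩
        · obtain ⟨y, hy, hxy, hyr⟩ := hupper x hxB hxv
          exact ⟨y, Finset.mem_insert_of_mem hy, hxy, by rwa [hr y hy, hr x hxB]⟩
      obtain ⟨B', r', hB', hsub, hst⟩ := ih hp.1 (B := insert u B) (r := Function.update r u t)
        (Finset.mem_insert_of_mem hv) (Finset.mem_insert_of_mem ha) (Finset.mem_insert_self u B)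
        hua (by rw [hru]; exact htm) (by rw [hr a ha]; exact ham) hdisj'
        hinj' hlower' hupper'
      refine ⟨B', r', (Finset.subset_insert u B).trans hB', ?_, hst⟩
      intro w hw
      rw [Walk.support_cons, List.mem_cons] at hw
      rcases hw with rfl | hw
      · exact hB' (Finset.mem_insert_of_mem hq)
      · exact hsub w hw

/-- The initial segment of a walk up to its first vertex in `B`, as a path. -/
theorem exists_isPath_to_set {G : SimpleGraph V} {B : Set V} {u b : V}
    (p : G.Walk u b) (hb : b ∈ B) :
    ∃ b' ∈ B, ∃ q : G.Walk u b', q.IsPath ∧ (∀ w ∈ q.support, w = b' ∨ w ∉ B) ∧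
      ∀ w ∈ q.support, w ∈ p.support := by
  classical
  induction p with
  | nil => exact ⟨_, hb, Walk.nil, by simp, by simp, by simp⟩
  | @cons u x b h p ih =>
    by_cases hu : u ∈ B
    · exact ⟨u, hu, Walk.nil, by simp, by simp, by simp⟩
    · obtain ⟨b', hb', q, -, hqB, hqp⟩ := ih hb
      have hsub := (Walk.cons h q).support_bypass_subset_support
      refine ⟨b', hb', (Walk.cons h q).bypass, Walk.bypass_isPath _, ?_, ?_⟩
      · intro w hw
        have := hsub hw
        rw [Walk.support_cons, List.mem_cons] at this
        rcases this with rfl | hw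
        · exact Or.inr hu
        · exact hqB w hw
      · intro w hw
        have := hsub hw
        rw [Walk.support_cons, List.mem_cons] at this ⊢
        exact this.imp_right (hqp w)

/-- An st-numbering on a proper subset of a 2-connected graph extends. -/
theorem IsSTNumbering.exists_ssuperset [Fintype V] {G : SimpleGraph V} {v : V}
    (hconn : G.Preconnected) (hcut : ∀ x, (G.induce {x}ᶜ).Preconnected) {B : Finset V} {r : V → ℚ}
    (hr : IsSTNumbering G v B r) (hv : v ∈ B) (hB : 2 ≤ B.card) (hne : B ≠ Finset.univ) :
    ∃ (B' : Finset V) (r' : V → ℚ), B ⊂ B' ∧ IsSTNumbering G v B' r' := by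
  classical
  obtain ⟨x, hx⟩ : ∃ x, x ∉ B := by
    by_contra! h
    exact hne (Finset.eq_univ_iff_forall.2 h)
  obtain ⟨p₀⟩ := hconn v x
  obtain ⟨⟨⟨a, u⟩, hau⟩, -, ha, hu⟩ := p₀.exists_boundary_dart (B : Set V) hv hx
  replace ha : a ∈ B := ha
  replace hu : u ∉ B := hu
  replace hau : G.Adj a u := hau
  obtain ⟨b₀, hb₀, hb₀a⟩ := Finset.exists_mem_ne (by omega : 1 < B.card) a
  obtain ⟨p₁⟩ := hcut a ⟨u, hau.ne'⟩ ⟨b₀, hb₀a⟩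
  obtain ⟨p₂, hp₂⟩ : ∃ p : G.Walk u b₀, a ∉ p.support := by
    refine ⟨p₁.map (Embedding.induce _).toHom, fun h => ?_⟩
    obtain ⟨z, -, hz⟩ := List.mem_map.1 ((Walk.support_map _ p₁) ▸ h)
    exact z.2 hz
  obtain ⟨b, hb, q, hq, hqB, hqp⟩ := exists_isPath_to_set (B := (B : Set V)) p₂ hb₀
  have haq : a ∉ q.support := fun h => hp₂ (hqp a h)
  have hba : b ≠ a := fun h => haq (h ▸ q.end_mem_support)
  have hpath : (Walk.cons hau q).IsPath := (Walk.cons_isPath_iff ..).2 ⟨hq, haq⟩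
  have hdisj : ∀ w ∈ (Walk.cons hau q).support, w = a ∨ w = b ∨ w ∉ B := by
    intro w hw
    rw [Walk.support_cons, List.mem_cons] at hw
    exact hw.imp_right (hqB w)
  have main : ∀ {c d : V} (p : G.Walk d c), p.IsPath → c ∈ B → d ∈ B → d ≠ c →
      (c = v ∨ r c < r d) → (∀ w ∈ p.support, w = d ∨ w = c ∨ w ∉ B) → u ∈ p.support →
      ∃ (B' : Finset V) (r' : V → ℚ), B ⊂ B' ∧ IsSTNumbering G v B' r' := by
    intro c d p hp hc hd hdc hcd hdis hup
    obtain ⟨m, hm, hcm⟩ : ∃ m, m < r d ∧ (c = v ∨ r c ≤ m) := by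
      rcases hcd with h | h
      · exact ⟨r d - 1, by linarith, Or.inl h⟩
      · exact ⟨r c, h, Or.inr le_rfl⟩
    obtain ⟨B', r', hBB', hsub, hst⟩ := exists_isSTNumbering_of_ear p hp hv hc hd hdc hm hcm hdis
      hr.injOn (fun x hx hxv _ => hr.lower x hx hxv) hr.upper
    exact ⟨B', r', (Finset.ssubset_iff_of_subset hBB').2 ⟨u, hsub u hup, hu⟩, hst⟩
  have hcase : (b = v ∨ r b < r a) ∨ (a = v ∨ r a < r b) := by
    rcases lt_trichotomy (r a) (r b) with h | h | h
    · exact Or.inr (Or.inr h)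
    · exact absurd (hr.injOn ha hb h).symm hba
    · exact Or.inl (Or.inr h)
  rcases hcase with h | h
  · exact main _ hpath hb ha hba.symm h hdisj (by simp)
  · refine main (Walk.cons hau q).reverse hpath.reverse ha hb hba h ?_ (by simp)
    intro w hw
    rw [Walk.support_reverse, List.mem_reverse] at hw
    rcases hdisj w hw with h | h | h
    exacts [Or.inr (Or.inl h), Or.inl h, Or.inr (Or.inr h)]

/-- A graph with an edge at `v` and without cut-vertices has an st-numbering with `s = t = v`. -/
theorem exists_isSTNumbering_univ [Fintype V] {G : SimpleGraph V} {v w : V} (hvw : G.Adj v w)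
    (hconn : G.Preconnected) (hcut : ∀ x, (G.induce {x}ᶜ).Preconnected) :
    ∃ r : V → ℚ, IsSTNumbering G v Finset.univ r := by
  classical
  have hstart : IsSTNumbering G v {v, w} (fun x => if x = v then 0 else 1) := by
    have hmem : ∀ x ∈ ({v, w} : Finset V), x ≠ v → x = w := by
      intro x hx hxv
      simpa [hxv] using hx
    refine ⟨?_, ?_, ?_⟩
    · intro x hx y hy hxy
      by_cases hxv : x = v <;> by_cases hyv : y = v
      · rw [hxv, hyv]
      · simp [hxv, hyv] at hxy
      · simp [hxv, hyv] at hxy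
      · rw [hmem x hx hxv, hmem y hy hyv]
    · intro x hx hxv
      exact ⟨v, by simp, hmem x hx hxv ▸ hvw.symm, Or.inl rfl⟩
    · intro x hx hxv
      exact ⟨v, by simp, hmem x hx hxv ▸ hvw.symm, Or.inl rfl⟩
  obtain ⟨B, hle, hmax⟩ := (Set.toFinite
    {B : Finset V | ∃ r : V → ℚ, IsSTNumbering G v B r}).exists_le_maximal ⟨_, hstart⟩
  obtain ⟨r, hr⟩ := hmax.prop
  have hcard : 2 ≤ B.card := by
    rw [← Finset.card_pair hvw.ne]
    exact Finset.card_le_card hle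
  by_cases hB : B = Finset.univ
  · exact ⟨r, hB ▸ hr⟩
  · obtain ⟨B', r', hlt, hst⟩ := hr.exists_ssuperset hconn hcut (hle (by simp)) hcard hB
    exact absurd hlt (hmax.not_gt ⟨r', hst⟩)

theorem IsSTNumbering.exists_lower_walk [Fintype V] {G : SimpleGraph V} {v : V} {r : V → ℚ}
    (hr : IsSTNumbering G v Finset.univ r) (x : V) :
    ∃ p : G.Walk v x, p.support.tail.Nodup ∧ ∀ z ∈ p.support.tail, z ≠ v ∧ r z ≤ r x := by
  induction x using (Finite.wellFounded_of_trans_of_irrefl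
    (InvImage (· < ·) r)).induction with
  | _ x ih =>
    by_cases hxv : x = v
    · subst hxv
      exact ⟨Walk.nil, by simp, by simp⟩
    · obtain ⟨y, -, hxy, hy⟩ := hr.lower x (Finset.mem_univ x) hxv
      obtain ⟨p, hp, hpz⟩ : ∃ p : G.Walk v y, p.support.tail.Nodup ∧
          ∀ z ∈ p.support.tail, z ≠ v ∧ r z < r x := by
        rcases hy with rfl | hy
        · exact ⟨Walk.nil, by simp, by simp⟩
        · obtain ⟨p, hp, hpz⟩ := ih y hy
          exact ⟨p, hp, fun z hz => ⟨(hpz z hz).1, (hpz z hz).2.trans_lt hy⟩⟩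
      refine ⟨p.append (Walk.cons hxy.symm Walk.nil), ?_, ?_⟩
      · rw [Walk.tail_support_append]
        refine List.Nodup.append hp (by simp) ?_
        intro z hz hz'
        have hzx : z = x := by simpa using hz'
        exact absurd (hpz z hz).2 (by simp [hzx])
      · intro z hz
        rw [Walk.tail_support_append, List.mem_append] at hz
        rcases hz with hz | hz
        · exact ⟨(hpz z hz).1, (hpz z hz).2.le⟩
        · have hzx : z = x := by simpa using hz
          exact ⟨hzx ▸ hxv, hzx ▸ le_rfl⟩

theorem IsSTNumbering.exists_upper_walk [Fintype V] {G : SimpleGraph V} {v : V} {r : V → ℚ}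
    (hr : IsSTNumbering G v Finset.univ r) (x : V) :
    ∃ p : G.Walk x v, p.IsPath ∧ ∀ z ∈ p.support.tail, z = v ∨ r x < r z := by
  induction x using (Finite.wellFounded_of_trans_of_irrefl
    (InvImage (· > ·) r)).induction with
  | _ x ih =>
    by_cases hxv : x = v
    · subst hxv
      exact ⟨Walk.nil, by simp, by simp⟩
    · obtain ⟨y, -, hxy, hy⟩ := hr.upper x (Finset.mem_univ x) hxv
      obtain ⟨p, hp, hpz⟩ : ∃ p : G.Walk y v, p.IsPath ∧
          ∀ z ∈ p.support, z = v ∨ r x < r z := by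
        rcases hy with rfl | hy
        · exact ⟨Walk.nil, by simp, by simp⟩
        · obtain ⟨p, hp, hpz⟩ := ih y hy
          refine ⟨p, hp, fun z hz => ?_⟩
          rw [← Walk.cons_tail_support, List.mem_cons] at hz
          rcases hz with rfl | hz
          · exact Or.inr hy
          · exact (hpz z hz).imp_right hy.trans
      refine ⟨Walk.cons hxy p, (Walk.cons_isPath_iff ..).2 ⟨hp, fun h => ?_⟩, by simpa using hpz⟩
      exact (hpz x h).elim hxv (lt_irrefl _)

/-- A non-bipartite graph with an st-numbering at `s = t = v` has an odd cycle through `v`. -/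
theorem IsSTNumbering.exists_odd_closed_walk [Fintype V] {G : SimpleGraph V} {v : V} {r : V → ℚ}
    (hr : IsSTNumbering G v Finset.univ r) (hnonbip : ¬ G.Colorable 2) :
    ∃ c : G.Walk v v, Odd c.length ∧ c.support.tail.Nodup := by
  by_contra! hno
  have heven : ∀ c : G.Walk v v, c.support.tail.Nodup → Even c.length := fun c hc =>
    Nat.not_odd_iff_even.1 fun h => hno c h hc
  choose P hP hPz using hr.exists_lower_walk
  choose Q hQ hQz using hr.exists_upper_walk
  have hPQ : ∀ x, Even ((P x).length + (Q x).length) := by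
    intro x
    rw [← Walk.length_append]
    apply heven
    rw [Walk.tail_support_append]
    refine List.Nodup.append (hP x) (hQ x).support_nodup.tail ?_
    intro z hz hz'
    rcases hQz x z hz' with h | h
    · exact (hPz x z hz).1 h
    · exact absurd (hPz x z hz).2 h.not_ge
  have hstep : ∀ x y, G.Adj x y → r x < r y →
      Even ((P x).length + ((Q y).length + 1)) := by
    intro x y hxy hlt
    have := heven ((P x).append (Walk.cons hxy (Q y))) ?_
    · simpa using this
    rw [Walk.tail_support_append]
    refine List.Nodup.append (hP x) (by simpa using (hQ y).support_nodup) ?_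
    intro z hz hz'
    rw [Walk.support_cons, List.tail_cons, ← Walk.cons_tail_support, List.mem_cons] at hz'
    obtain ⟨hzv, hzx⟩ := hPz x z hz
    rcases hz' with rfl | hz'
    · exact absurd hzx hlt.not_ge
    · rcases hQz y z hz' with h | h
      · exact hzv h
      · exact absurd hzx (hlt.trans h).not_ge
  apply hnonbip
  refine ⟨Coloring.mk (fun x => (⟨(P x).length % 2, Nat.mod_lt _ two_pos⟩ : Fin 2)) ?_⟩
  intro x y hxy heq
  have heq' : (P x).length % 2 = (P y).length % 2 := congrArg Fin.val heq
  have hx := hPQ x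
  have hy := hPQ y
  rw [Nat.even_iff] at hx hy
  rcases lt_trichotomy (r x) (r y) with h | h | h
  · have := hstep x y hxy h
    rw [Nat.even_iff] at this
    omega
  · exact hxy.ne (hr.injOn (by simp) (by simp) h)
  · have := hstep y x hxy.symm h
    rw [Nat.even_iff] at this
    omega

/-- Every finite 2-connected non-bipartite graph has two level-disjoint
partitions rooted at any given vertex. -/
theorem two_connected_nonbipartite_two_rooted_LDPs {V : Type*} [Fintype V] [DecidableEq V]
    (G : SimpleGraph V) (h2c : TwoConnectedOn G Set.univ)
    (hnonbip : ¬ G.Colorable 2) (v : V) :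
    ∃ S T : List (Finset V),
      IsLevelPartition G S ∧ RootedAt v S ∧
      IsLevelPartition G T ∧ RootedAt v T ∧ LevelDisjoint S T := by
  obtain ⟨hconn, hcard, hcut⟩ := h2c
  have hcut' : ∀ x, (G.induce {x}ᶜ).Preconnected := by
    intro x
    rw [Set.compl_eq_univ_sdiff]
    exact hcut x (Set.mem_univ x)
  have hpre : G.Preconnected :=
    (induceUnivIso G).preconnected_iff.1 hconn.preconnected
  have : Nontrivial V := by
    rw [← Fintype.one_lt_card_iff_nontrivial, ← Nat.card_eq_fintype_card, ← Set.ncard_univ]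
    omega
  obtain ⟨w, hvw⟩ := hpre.exists_adj_of_nontrivial v
  obtain ⟨r, hr⟩ := exists_isSTNumbering_univ hvw hpre hcut'
  obtain ⟨c, hodd, hnodup⟩ := hr.exists_odd_closed_walk hnonbip
  obtain ⟨U, f₀, g₀, hv, ⟨u, hu, huv⟩, hf₀, hg₀, hfg₀⟩ :=
    exists_isDepthOn_of_odd_closed_walk c hodd hnodup
  obtain ⟨f, g, hf, hg, hfg⟩ := exists_isDepthOn_univ (hcut' v) hv hu huv hf₀ hg₀ hfg₀
  refine ⟨levelList f, levelList g, hf.isLevelPartition.1, hf.isLevelPartition.2,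
    hg.isLevelPartition.1, hg.isLevelPartition.2, ?_⟩
  intro i hi _ _
  rw [Finset.disjoint_left]
  intro x hx hx'
  rw [mem_levelList_getD] at hx hx'
  exact hfg x (by rintro rfl; have := hf.1; omega) (hx.trans hx'.symm)
end
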